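/- Let X be a nonempty preconnected topological space, let g : X → X be a map such that the n-fold iterate g^[n] is the identity for some positive integer n, and let f : X → ℝ be a function such that the difference function x ↦ f(g(x)) − f(x) is locally constant. Then f ∘ g = f, i.e. f(g(x)) = f(x) for every x ∈ X. -/

import Mathlib

theorem apply_iterate_eq_add_nsmul {X M : Type*} [AddMonoid M] {g : X → X} {f : X → M} {c : M}
    (h : ∀ x, f (g x) = f x + c) (k : ℕ) (x : X) : f (g^[k] x) = f x + k • c := by
  induction k with
  | zero => simp
  | succ k ih => rw [Function.iterate_succ_apply', h, ih, succ_nsmul, add_assoc]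

/-- If `X` is a nonempty preconnected topological space, `g : X → X` satisfies
`g^[n] = id` for some positive `n`, and `f : X → ℝ` is such that
`x ↦ f (g x) - f x` is locally constant, then `f ∘ g = f`. -/
theorem finite_order_symmetry_invariance
    {X : Type*} [TopologicalSpace X] [Nonempty X] [PreconnectedSpace X]
    (g : X → X) (n : ℕ) (hn : 0 < n) (hgn : g^[n] = id)
    (f : X → ℝ) (hf : IsLocallyConstant (fun x => f (g x) - f x)) :
    ∀ x : X, f (g x) = f x := by
  intro x
  have step (y : X) : f (g y) = f y + (f (g x) - f x) :=
    sub_eq_iff_eq_add'.mp (hf.apply_eq_of_preconnectedSpace y x)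
  have total := apply_iterate_eq_add_nsmul step n x
  rw [hgn, id_eq, left_eq_add, smul_eq_zero_iff_right hn.ne'] at total
  exact sub_eq_zero.mp total
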